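/- Let X be a fractional Brownian motion with Hurst parameter 0 < H < 1, let w : [0,1] → ℝ be of bounded variation, and let (s_k, ξ_k) satisfy s_k → 0 and s_k ξ_k → L. Then lim_{k→∞} s_k^{-pH} E[|∫_0^{s_k} w(u/s_k) e^{iξ_k u} dX(u)|^p] = E[|∫_0^1 w(u) e^{iLu} dX(u)|^p] for any 1 ≤ p < ∞. -/

import Mathlib

open MeasureTheory ProbabilityTheory Real Filter Set Finset

/-- `I` is the (Young/stochastic) integral `∫_0^a f dX` in the sense that along every
sequence of partitions of `[0,a]` with mesh tending to zero the Riemann sums converge in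
probability to `I`. -/
def IsStochInt {Ω : Type} [MeasurableSpace Ω] (μ : Measure Ω) (X : ℝ → Ω → ℝ)
    (f : ℝ → ℂ) (a : ℝ) (I : Ω → ℂ) : Prop :=
  ∀ (K : ℕ → ℕ) (tt : (n : ℕ) → Fin (K n + 1) → ℝ),
    (∀ n, tt n 0 = 0) → (∀ n, tt n (Fin.last (K n)) = a) → (∀ n, Monotone (tt n)) →
    Tendsto (fun n => ⨆ k : Fin (K n), (tt n k.succ - tt n k.castSucc)) atTop (nhds 0) →
    TendstoInMeasure μ (fun n ω => ∑ k : Fin (K n),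
      f (tt n k.castSucc) * ((X (tt n k.succ) ω - X (tt n k.castSucc) ω : ℝ) : ℂ)) atTop I

theorem tendsto_eLpNorm_of_tendstoInMeasure_of_bddAbove {Ω E : Type*} [MeasurableSpace Ω]
    [NormedAddCommGroup E] {μ : Measure Ω} [IsFiniteMeasure μ] {f : ℕ → Ω → E} {g : Ω → E}
    {p q B : ENNReal} (hp : 1 ≤ p) (hpq : p < q) (hq : q ≠ ⊤) (hB : B ≠ ⊤)
    (hf : ∀ n, AEStronglyMeasurable (f n) μ) (hfB : ∀ n, eLpNorm (f n) q μ ≤ B)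
    (hfg : TendstoInMeasure μ f atTop g) :
    MemLp g p μ ∧ Tendsto (fun n => eLpNorm (f n) p μ) atTop (nhds (eLpNorm g p μ)) := by
  have hp_top : p ≠ ⊤ := hpq.ne_top
  have hg : MemLp g p μ := by
    have : MemLp g q μ := ⟨hfg.aestronglyMeasurable hf,
      (eLpNorm_le_of_tendstoInMeasure (Eventually.of_forall hfB) hfg hf).trans_lt hB.lt_top⟩
    exact this.mono_exponent hpq.le
  refine ⟨hg, ?_⟩
  have hr : 0 < 1 / p.toReal - 1 / q.toReal := by
    have h1 : p.toReal < q.toReal := (ENNReal.toReal_lt_toReal hp_top hq).2 hpq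
    have h0 : 0 < p.toReal := ENNReal.toReal_pos (by positivity) hp_top
    exact sub_pos.2 (one_div_lt_one_div_of_lt h0 h1)
  have hui : UnifIntegrable f p μ := by
    intro ε hε
    have hB' : 0 < B.toReal + 1 := by positivity
    refine ⟨(ε / (B.toReal + 1)) ^ (1 / p.toReal - 1 / q.toReal)⁻¹, by positivity, ?_⟩
    intro i s hs hμs
    rw [eLpNorm_indicator_eq_eLpNorm_restrict hs]
    calc eLpNorm (f i) p (μ.restrict s)
        ≤ eLpNorm (f i) q (μ.restrict s) *
            (μ.restrict s) Set.univ ^ (1 / p.toReal - 1 / q.toReal) :=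
          eLpNorm_le_eLpNorm_mul_rpow_measure_univ hpq.le (hf i).restrict
      _ ≤ B * (ENNReal.ofReal ((ε / (B.toReal + 1)) ^ (1 / p.toReal - 1 / q.toReal)⁻¹))
            ^ (1 / p.toReal - 1 / q.toReal) := by
          rw [Measure.restrict_apply_univ]
          gcongr
          exact (eLpNorm_mono_measure _ Measure.restrict_le_self).trans (hfB i)
      _ = ENNReal.ofReal (B.toReal * (ε / (B.toReal + 1))) := by
          rw [ENNReal.ofReal_rpow_of_nonneg (by positivity) hr.le,
            Real.rpow_inv_rpow (by positivity) hr.ne', ENNReal.ofReal_mul (by positivity),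
            ENNReal.ofReal_toReal hB]
      _ ≤ ENNReal.ofReal ε := by
          apply ENNReal.ofReal_le_ofReal
          rw [mul_div_assoc', div_le_iff₀ hB']
          nlinarith
  have hlim := tendsto_Lp_finite_of_tendstoInMeasure hp hp_top hf hg hui hfg
  have hup : Tendsto (fun n => eLpNorm g p μ + eLpNorm (f n - g) p μ) atTop
      (nhds (eLpNorm g p μ)) := by simpa using tendsto_const_nhds.add hlim
  have hlo : Tendsto (fun n => eLpNorm g p μ - eLpNorm (f n - g) p μ) atTop
      (nhds (eLpNorm g p μ)) := by
    simpa using ENNReal.Tendsto.sub tendsto_const_nhds hlim (Or.inl hg.2.ne)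
  refine tendsto_of_tendsto_of_tendsto_of_le_of_le hlo hup (fun n => ?_) (fun n => ?_)
  · rw [tsub_le_iff_right]
    have := eLpNorm_sub_le (hf n) ((hf n).sub hg.1) hp
    simpa using this
  · have := eLpNorm_add_le hg.1 ((hf n).sub hg.1) hp
    simpa using this

section Gaussian

variable {Ω : Type*} [MeasurableSpace Ω] {μ : Measure Ω} {X : ℝ → Ω → ℝ}

theorem map_eq_gaussianReal_integral_sq {Y : Ω → ℝ} (hY : Measurable Y) {v : NNReal}
    (h : Measure.map Y μ = gaussianReal 0 v) :
    Measure.map Y μ = gaussianReal 0 (∫ ω, Y ω ^ 2 ∂μ).toNNReal := by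
  have h1 : ∫ ω, Y ω ^ 2 ∂μ = v := by
    have h2 := integral_map (μ := μ) hY.aemeasurable
      (f := fun x : ℝ => x ^ 2) (by fun_prop)
    rw [← h2, h, ← variance_id_gaussianReal (μ := 0) (v := v), variance_eq_integral (by fun_prop)]
    simp
  rw [h1, h, Real.toNNReal_coe]

theorem integral_sq_sum_of_gaussian [IsProbabilityMeasure μ] (hXmeas : ∀ r, Measurable (X r))
    (hgauss : ∀ (n : ℕ) (r : Fin n → ℝ) (c : Fin n → ℝ), ∃ v : NNReal,
      Measure.map (fun ω => ∑ i, c i * X (r i) ω) μ = gaussianReal 0 v)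
    {n : ℕ} (r c : Fin n → ℝ) :
    ∫ ω, (∑ i, c i * X (r i) ω) ^ 2 ∂μ =
      ∑ i, ∑ j, c i * c j * ∫ ω, X (r i) ω * X (r j) ω ∂μ := by
  have hL (t : ℝ) : MemLp (X t) 2 μ := by
    obtain ⟨v, hv⟩ := hgauss 1 (fun _ => t) (fun _ => 1)
    simp only [Fin.sum_univ_one, one_mul] at hv
    have := memLp_id_gaussianReal (μ := 0) (v := v) 2
    exact ((memLp_map_measure_iff (by fun_prop) (hXmeas t).aemeasurable).1 (hv ▸ this))
  simp_rw [sq, Finset.sum_mul_sum]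
  have hint (i j : Fin n) : Integrable
      (fun ω => c i * X (r i) ω * (c j * X (r j) ω)) μ :=
    ((hL (r i)).const_mul (c i)).integrable_mul ((hL (r j)).const_mul (c j))
  rw [integral_finsetSum _ fun i _ => integrable_finsetSum _ fun j _ => hint i j]
  refine Finset.sum_congr rfl fun i _ => ?_
  rw [integral_finsetSum _ fun j _ => hint i j]
  refine Finset.sum_congr rfl fun j _ => ?_
  rw [← integral_const_mul]
  congr 1 with ω
  ring

theorem map_sum_scaling [IsProbabilityMeasure μ] {H : ℝ} (hH : 0 < H)
    (hXmeas : ∀ r, Measurable (X r))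
    (hgauss : ∀ (n : ℕ) (r : Fin n → ℝ) (c : Fin n → ℝ), ∃ v : NNReal,
      Measure.map (fun ω => ∑ i, c i * X (r i) ω) μ = gaussianReal 0 v)
    (hcov : ∀ a b : ℝ,
      (∫ ω, X a ω * X b ω ∂μ) = (|a| ^ (2 * H) + |b| ^ (2 * H) - |a - b| ^ (2 * H)) / 2)
    {s : ℝ} (hs : 0 ≤ s) {n : ℕ} (r c : Fin n → ℝ) :
    Measure.map (fun ω => ∑ i, c i * X (s * r i) ω) μ =
      Measure.map (fun ω => ∑ i, s ^ H * c i * X (r i) ω) μ := by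
  obtain ⟨v, hv⟩ := hgauss n (fun i => s * r i) c
  obtain ⟨v', hv'⟩ := hgauss n r (fun i => s ^ H * c i)
  rw [map_eq_gaussianReal_integral_sq (by fun_prop) hv,
    map_eq_gaussianReal_integral_sq (by fun_prop) hv',
    integral_sq_sum_of_gaussian hXmeas hgauss, integral_sq_sum_of_gaussian hXmeas hgauss]
  congr 2
  refine Finset.sum_congr rfl fun i _ => Finset.sum_congr rfl fun j _ => ?_
  have hsH : s ^ (2 * H) = s ^ H * s ^ H := by
    rw [two_mul, Real.rpow_add_of_nonneg hs hH.le hH.le]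
  rw [hcov, hcov, ← mul_sub, abs_mul, abs_mul, abs_mul, abs_of_nonneg hs,
    Real.mul_rpow hs (abs_nonneg _), Real.mul_rpow hs (abs_nonneg _),
    Real.mul_rpow hs (abs_nonneg _), hsH]
  ring

theorem map_complex_sum_scaling [IsProbabilityMeasure μ] {H : ℝ} (hH : 0 < H)
    (hXmeas : ∀ r, Measurable (X r))
    (hgauss : ∀ (n : ℕ) (r : Fin n → ℝ) (c : Fin n → ℝ), ∃ v : NNReal,
      Measure.map (fun ω => ∑ i, c i * X (r i) ω) μ = gaussianReal 0 v)
    (hcov : ∀ a b : ℝ,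
      (∫ ω, X a ω * X b ω ∂μ) = (|a| ^ (2 * H) + |b| ^ (2 * H) - |a - b| ^ (2 * H)) / 2)
    {s : ℝ} (hs : 0 ≤ s) {n : ℕ} (r : Fin n → ℝ) (c : Fin n → ℂ) :
    Measure.map (fun ω => ∑ i, c i * (X (s * r i) ω : ℂ)) μ =
      Measure.map (fun ω => (s ^ H : ℝ) * ∑ i, c i * (X (r i) ω : ℂ)) μ := by
  have hm1 : Measurable (fun ω => ∑ i, c i * (X (s * r i) ω : ℂ)) := by fun_prop
  have hm2 : Measurable (fun ω => (s ^ H : ℝ) * ∑ i, c i * (X (r i) ω : ℂ)) := by fun_prop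
  have := Measure.isProbabilityMeasure_map (μ := μ) hm1.aemeasurable
  have := Measure.isProbabilityMeasure_map (μ := μ) hm2.aemeasurable
  refine Measure.ext_of_charFun (funext fun z => ?_)
  rw [charFun_apply, charFun_apply, integral_map hm1.aemeasurable (by fun_prop),
    integral_map hm2.aemeasurable (by fun_prop)]
  have key := map_sum_scaling hH hXmeas hgauss hcov hs r (fun i => inner ℝ (c i) z)
  have hg : AEStronglyMeasurable (fun x : ℝ => Complex.exp (x * Complex.I))
    (Measure.map (fun ω => ∑ i, inner ℝ (c i) z * X (s * r i) ω) μ) := by fun_prop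
  have h1 := integral_map (by fun_prop) hg
  rw [key, integral_map (by fun_prop) (by fun_prop)] at h1
  have e1 (ω : Ω) : inner ℝ (∑ i, c i * (X (s * r i) ω : ℂ)) z =
      ∑ i, inner ℝ (c i) z * X (s * r i) ω := by
    rw [sum_inner]
    refine Finset.sum_congr rfl fun i _ => ?_
    simp only [Complex.inner, Complex.mul_re, map_mul, Complex.conj_ofReal,
      Complex.mul_im, Complex.ofReal_re, Complex.ofReal_im, Complex.conj_re, Complex.conj_im]
    ring
  have e2 (ω : Ω) : inner ℝ ((s ^ H : ℝ) * ∑ i, c i * (X (r i) ω : ℂ)) z =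
      ∑ i, s ^ H * inner ℝ (c i) z * X (r i) ω := by
    rw [Finset.mul_sum, sum_inner]
    refine Finset.sum_congr rfl fun i _ => ?_
    simp only [Complex.inner, Complex.mul_re, map_mul, Complex.conj_ofReal,
      Complex.mul_im, Complex.ofReal_re, Complex.ofReal_im, Complex.conj_re, Complex.conj_im]
    ring
  simp_rw [e1, e2]
  exact h1.symm

theorem eLpNorm_complex_sum_scaling [IsProbabilityMeasure μ] {H : ℝ} (hH : 0 < H)
    (hXmeas : ∀ r, Measurable (X r))
    (hgauss : ∀ (n : ℕ) (r : Fin n → ℝ) (c : Fin n → ℝ), ∃ v : NNReal,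
      Measure.map (fun ω => ∑ i, c i * X (r i) ω) μ = gaussianReal 0 v)
    (hcov : ∀ a b : ℝ,
      (∫ ω, X a ω * X b ω ∂μ) = (|a| ^ (2 * H) + |b| ^ (2 * H) - |a - b| ^ (2 * H)) / 2)
    (q : ENNReal) {s : ℝ} (hs : 0 ≤ s) {n : ℕ} (r : Fin n → ℝ) (c : Fin n → ℂ) :
    eLpNorm (fun ω => ∑ i, c i * (X (s * r i) ω : ℂ)) q μ =
      ENNReal.ofReal (s ^ H) * eLpNorm (fun ω => ∑ i, c i * (X (r i) ω : ℂ)) q μ := by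
  have h (F : Ω → ℂ) (hF : Measurable F) : eLpNorm F q μ = eLpNorm id q (Measure.map F μ) := by
    rw [eLpNorm_map_measure (by fun_prop) hF.aemeasurable, Function.id_comp]
  rw [h _ (by fun_prop), map_complex_sum_scaling hH hXmeas hgauss hcov hs, ← h _ (by fun_prop)]
  have := eLpNorm_const_smul ((s ^ H : ℝ) : ℂ) (fun ω => ∑ i, c i * (X (r i) ω : ℂ)) q μ
  simp only [Pi.smul_def, smul_eq_mul] at this
  rw [this, ← ofReal_norm, Complex.norm_of_nonneg (by positivity)]

theorem eLpNorm_le_eLpNorm_one [IsProbabilityMeasure μ] {H : ℝ} (hH : 0 < H)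
    (hXmeas : ∀ r, Measurable (X r))
    (hgauss : ∀ (n : ℕ) (r : Fin n → ℝ) (c : Fin n → ℝ), ∃ v : NNReal,
      Measure.map (fun ω => ∑ i, c i * X (r i) ω) μ = gaussianReal 0 v)
    (hcov : ∀ a b : ℝ,
      (∫ ω, X a ω * X b ω ∂μ) = (|a| ^ (2 * H) + |b| ^ (2 * H) - |a - b| ^ (2 * H)) / 2)
    (q : ENNReal) {t : ℝ} (ht : t ∈ Set.Icc (0 : ℝ) 1) :
    eLpNorm (fun ω => (X t ω : ℂ)) q μ ≤ eLpNorm (fun ω => (X 1 ω : ℂ)) q μ := by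
  have h := eLpNorm_complex_sum_scaling hH hXmeas hgauss hcov q ht.1
    (fun _ : Fin 1 => (1 : ℝ)) (fun _ => (1 : ℂ))
  simp only [Fin.sum_univ_one, one_mul, mul_one] at h
  rw [h]
  refine mul_le_of_le_one_left' ?_
  exact ENNReal.ofReal_le_one.2 (Real.rpow_le_one ht.1 ht.2 hH.le)

theorem memLp_of_gaussian
    (hXmeas : ∀ r, Measurable (X r))
    (hgauss : ∀ (n : ℕ) (r : Fin n → ℝ) (c : Fin n → ℝ), ∃ v : NNReal,
      Measure.map (fun ω => ∑ i, c i * X (r i) ω) μ = gaussianReal 0 v)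
    {q : ENNReal} (hq : q ≠ ⊤) (t : ℝ) : MemLp (fun ω => (X t ω : ℂ)) q μ := by
  obtain ⟨v, hv⟩ := hgauss 1 (fun _ => t) (fun _ => 1)
  simp only [Fin.sum_univ_one, one_mul] at hv
  have h := memLp_id_gaussianReal' (μ := 0) (v := v) q hq
  have h' : MemLp (X t) q μ :=
    (memLp_map_measure_iff (g := id) (by fun_prop) (hXmeas t).aemeasurable).1 (hv ▸ h)
  exact h'.ofReal

end Gaussian

theorem sum_mul_sub_eq {R : Type*} [CommRing R] (a x : ℕ → R) (N : ℕ) :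
    ∑ j ∈ Finset.range N, a j * (x (j + 1) - x j) =
      a N * x N - a 0 * x 0 - ∑ j ∈ Finset.range N, (a (j + 1) - a j) * x (j + 1) := by
  induction N with
  | zero => simp
  | succ N ih => rw [Finset.sum_range_succ, Finset.sum_range_succ, ih]; ring

theorem exists_sum_mul_sub_eq {R : Type*} [CommRing R] (a : ℕ → R) (N : ℕ) :
    ∃ b : Fin (N + 1) → R, ∀ x : ℕ → R,
      ∑ j ∈ Finset.range N, a j * (x (j + 1) - x j) = ∑ i, b i * x i := by
  induction N with
  | zero => exact ⟨0, by simp⟩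
  | succ N ih =>
    obtain ⟨b, hb⟩ := ih
    refine ⟨Fin.snoc (fun i => b i - if i = Fin.last N then a N else 0) (a N), fun x => ?_⟩
    rw [Finset.sum_range_succ, hb, Fin.sum_univ_castSucc (n := N + 1)]
    simp [sub_mul, ite_mul]
    ring

theorem eLpNorm_sum_mul_sub_le {Ω : Type*} [MeasurableSpace Ω] {μ : Measure Ω} {q C : ENNReal}
    (hq : 1 ≤ q) (a : ℕ → ℂ) {Y : ℕ → Ω → ℂ} (hY : ∀ j, Measurable (Y j)) {N : ℕ}
    (hC : ∀ j ≤ N, eLpNorm (Y j) q μ ≤ C) :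
    eLpNorm (fun ω => ∑ j ∈ Finset.range N, a j * (Y (j + 1) ω - Y j ω)) q μ ≤
      ENNReal.ofReal (‖a N‖ + ‖a 0‖ + ∑ j ∈ Finset.range N, ‖a (j + 1) - a j‖) * C := by
  have hb (c : ℂ) {j : ℕ} (hj : j ≤ N) :
      eLpNorm (fun ω => c * Y j ω) q μ ≤ ENNReal.ofReal ‖c‖ * C := by
    have := eLpNorm_const_smul c (Y j) q μ
    simp only [Pi.smul_def, smul_eq_mul] at this
    rw [this, ← ofReal_norm]
    gcongr
    exact hC j hj
  have e : (fun ω => ∑ j ∈ Finset.range N, a j * (Y (j + 1) ω - Y j ω)) =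
      (fun ω => a N * Y N ω) - (fun ω => a 0 * Y 0 ω) -
        ∑ j ∈ Finset.range N, (fun ω => (a (j + 1) - a j) * Y (j + 1) ω) := by
    ext ω
    simp only [Pi.sub_apply, Finset.sum_apply]
    exact sum_mul_sub_eq a (fun j => Y j ω) N
  rw [e, ENNReal.ofReal_add (by positivity) (by positivity),
    ENNReal.ofReal_add (by positivity) (by positivity), add_mul, add_mul,
    ENNReal.ofReal_sum_of_nonneg fun _ _ => norm_nonneg _, Finset.sum_mul]
  refine (eLpNorm_sub_le (by fun_prop) (by fun_prop) hq).trans (add_le_add ?_ ?_)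
  · refine (eLpNorm_sub_le (by fun_prop) (by fun_prop) hq).trans (add_le_add ?_ ?_)
    · exact hb _ le_rfl
    · exact hb _ N.zero_le
  · refine (eLpNorm_sum_le (fun _ _ => by fun_prop) hq).trans (Finset.sum_le_sum fun j hj => ?_)
    exact hb _ (Finset.mem_range.1 hj)

theorem exists_sum_norm_mul_le {w : ℝ → ℝ} (hw : eVariationOn w (Set.Icc 0 1) ≠ ⊤) :
    ∃ A : ℝ, 0 ≤ A ∧ ∀ (g : ℝ → ℂ) (G : ℝ), (∀ u ∈ Set.Icc (0 : ℝ) 1, ‖g u‖ ≤ G) →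
      (∀ u ∈ Set.Icc (0 : ℝ) 1, ∀ v ∈ Set.Icc (0 : ℝ) 1, ‖g u - g v‖ ≤ G * |u - v|) →
      ∀ (N : ℕ) (t : ℕ → ℝ), Monotone t → (∀ j ≤ N, t j ∈ Set.Icc (0 : ℝ) 1) →
        ‖(w (t N) : ℂ) * g (t N)‖ + ‖(w (t 0) : ℂ) * g (t 0)‖ +
          ∑ j ∈ Finset.range N,
            ‖(w (t (j + 1)) : ℂ) * g (t (j + 1)) - (w (t j) : ℂ) * g (t j)‖ ≤ A * G := by
  set V := (eVariationOn w (Set.Icc 0 1)).toReal with hV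
  set M := |w 0| + V with hM
  have hV0 : 0 ≤ V := ENNReal.toReal_nonneg
  have hM0 : 0 ≤ M := by positivity
  have hwM (u : ℝ) (hu : u ∈ Set.Icc (0 : ℝ) 1) : |w u| ≤ M := by
    have h1 := eVariationOn.edist_le w hu (Set.left_mem_Icc.2 zero_le_one)
    have h2 : |w u - w 0| ≤ V := by
      have := ENNReal.toReal_mono hw h1
      rwa [edist_dist, ENNReal.toReal_ofReal dist_nonneg, Real.dist_eq] at this
    have := abs_sub_abs_le_abs_sub (w u) (w 0)
    linarith
  refine ⟨M + M + (V + M), by positivity, fun g G hg hg' N t ht htN => ?_⟩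
  have hG : 0 ≤ G := (norm_nonneg _).trans (hg 0 (by simp))
  have hend (j : ℕ) (hj : j ≤ N) : ‖(w (t j) : ℂ) * g (t j)‖ ≤ M * G := by
    rw [norm_mul, Complex.norm_real]
    exact mul_le_mul (hwM _ (htN j hj)) (hg _ (htN j hj)) (norm_nonneg _) hM0
  have hvar : ∑ j ∈ Finset.range N, |w (t (j + 1)) - w (t j)| ≤ V := by
    have h := ENNReal.toReal_mono hw
      (eVariationOn.sum_le_of_monotoneOn_Iic (f := w) (n := N) (ht.monotoneOn _) htN)
    rw [ENNReal.toReal_sum fun _ _ => edist_ne_top _ _] at h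
    simpa only [edist_dist, Real.dist_eq, ENNReal.toReal_ofReal (abs_nonneg _)] using h
  have hstep : ∀ j ∈ Finset.range N,
      ‖(w (t (j + 1)) : ℂ) * g (t (j + 1)) - (w (t j) : ℂ) * g (t j)‖ ≤
        |w (t (j + 1)) - w (t j)| * G + M * G * (t (j + 1) - t j) := by
    intro j hj
    have hj1 := htN (j + 1) (Finset.mem_range.1 hj)
    have hj0 := htN j (Finset.mem_range.1 hj).le
    have e : (w (t (j + 1)) : ℂ) * g (t (j + 1)) - (w (t j) : ℂ) * g (t j) =
        ((w (t (j + 1)) - w (t j) : ℝ) : ℂ) * g (t (j + 1)) +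
          (w (t j) : ℂ) * (g (t (j + 1)) - g (t j)) := by
      push_cast; ring
    rw [e, mul_assoc]
    refine (norm_add_le _ _).trans (add_le_add ?_ ?_)
    · rw [norm_mul, Complex.norm_real, Real.norm_eq_abs]
      exact mul_le_mul_of_nonneg_left (hg _ hj1) (abs_nonneg _)
    · rw [norm_mul, Complex.norm_real, Real.norm_eq_abs]
      refine mul_le_mul (hwM _ hj0) ?_ (norm_nonneg _) hM0
      have := hg' _ hj1 _ hj0
      rwa [abs_of_nonneg (sub_nonneg.2 (ht j.le_succ))] at this
  have hsum := Finset.sum_le_sum hstep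
  rw [Finset.sum_add_distrib, ← Finset.sum_mul, ← Finset.mul_sum, Finset.sum_range_sub] at hsum
  have h1 : t N - t 0 ≤ 1 := by
    have := (htN N le_rfl).2
    have := (htN 0 N.zero_le).1
    linarith
  have h2 := mul_le_mul_of_nonneg_left h1 (mul_nonneg hM0 hG)
  have h3 := mul_le_mul_of_nonneg_right hvar hG
  have h4 := hend N le_rfl
  have h5 := hend 0 N.zero_le
  linarith

theorem norm_exp_I_mul_sub_exp_I_mul_le (a u v : ℝ) :
    ‖Complex.exp (Complex.I * a * u) - Complex.exp (Complex.I * a * v)‖ ≤ |a| * |u - v| := by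
  have e : Complex.exp (Complex.I * a * u) - Complex.exp (Complex.I * a * v) =
      Complex.exp (Complex.I * (a * v : ℝ)) *
        (Complex.exp (Complex.I * (a * (u - v) : ℝ)) - 1) := by
    rw [mul_sub, ← Complex.exp_add]
    push_cast
    ring_nf
  rw [e, norm_mul, mul_comm Complex.I ((a * v : ℝ) : ℂ), Complex.norm_exp_ofReal_mul_I, one_mul,
    ← abs_mul]
  simpa using Real.norm_exp_I_mul_ofReal_sub_one_le (x := a * (u - v))

theorem norm_exp_I_mul_mul (a u : ℝ) : ‖Complex.exp (Complex.I * a * u)‖ = 1 := by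
  rw [mul_assoc, ← Complex.ofReal_mul, mul_comm, Complex.norm_exp_ofReal_mul_I]

theorem exp_I_mul_sub_eq (a b u : ℝ) :
    Complex.exp (Complex.I * a * u) - Complex.exp (Complex.I * b * u) =
      Complex.exp (Complex.I * b * u) * (Complex.exp (Complex.I * (a - b : ℝ) * u) - 1) := by
  rw [mul_sub, ← Complex.exp_add]
  push_cast
  ring_nf

theorem norm_exp_I_mul_sub_one_le (a : ℝ) {u : ℝ} (hu : u ∈ Set.Icc (0 : ℝ) 1) :
    ‖Complex.exp (Complex.I * a * u) - 1‖ ≤ |a| := by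
  have h := norm_exp_I_mul_sub_exp_I_mul_le a u 0
  simp only [Complex.ofReal_zero, mul_zero, Complex.exp_zero, sub_zero] at h
  refine h.trans (mul_le_of_le_one_right (abs_nonneg _) ?_)
  rw [abs_of_nonneg hu.1]
  exact hu.2

theorem norm_exp_I_mul_sub_le (a b : ℝ) {u : ℝ} (hu : u ∈ Set.Icc (0 : ℝ) 1) :
    ‖Complex.exp (Complex.I * a * u) - Complex.exp (Complex.I * b * u)‖ ≤
      |a - b| * (1 + |b|) := by
  rw [exp_I_mul_sub_eq, norm_mul, norm_exp_I_mul_mul, one_mul]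
  have := norm_exp_I_mul_sub_one_le (a - b) hu
  nlinarith [abs_nonneg (a - b), abs_nonneg b]

theorem norm_exp_I_mul_sub_sub_le (a b : ℝ) {u v : ℝ} (hu : u ∈ Set.Icc (0 : ℝ) 1) :
    ‖(Complex.exp (Complex.I * a * u) - Complex.exp (Complex.I * b * u)) -
        (Complex.exp (Complex.I * a * v) - Complex.exp (Complex.I * b * v))‖ ≤
      |a - b| * (1 + |b|) * |u - v| := by
  have e : (Complex.exp (Complex.I * a * u) - Complex.exp (Complex.I * b * u)) -
        (Complex.exp (Complex.I * a * v) - Complex.exp (Complex.I * b * v)) =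
      (Complex.exp (Complex.I * b * u) - Complex.exp (Complex.I * b * v)) *
          (Complex.exp (Complex.I * (a - b : ℝ) * u) - 1) +
        Complex.exp (Complex.I * b * v) * (Complex.exp (Complex.I * (a - b : ℝ) * u) -
          Complex.exp (Complex.I * (a - b : ℝ) * v)) := by
    rw [exp_I_mul_sub_eq, exp_I_mul_sub_eq]
    ring
  rw [e]
  refine (norm_add_le _ _).trans ?_
  rw [norm_mul, norm_mul, norm_exp_I_mul_mul, one_mul]
  have h1 := mul_le_mul (norm_exp_I_mul_sub_exp_I_mul_le b u v)
    (norm_exp_I_mul_sub_one_le (a - b) hu) (norm_nonneg _) (by positivity)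
  have h2 := norm_exp_I_mul_sub_exp_I_mul_le (a - b) u v
  linarith

theorem IsStochInt.tendstoInMeasure_uniform {Ω : Type} [MeasurableSpace Ω] {μ : Measure Ω}
    {X : ℝ → Ω → ℝ} {f : ℝ → ℂ} {a : ℝ} {I : Ω → ℂ} (h : IsStochInt μ X f a I) (ha : 0 ≤ a) :
    TendstoInMeasure μ (fun (n : ℕ) ω => ∑ j ∈ Finset.range (n + 1),
      f (a * ((j : ℝ) / (n + 1))) *
        ((X (a * (((j + 1 : ℕ) : ℝ) / (n + 1))) ω : ℂ) - X (a * ((j : ℝ) / (n + 1))) ω))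
      atTop I := by
  have h1 := h (fun n => n + 1) (fun n i => a * (((i : ℕ) : ℝ) / (n + 1))) (by simp) ?_ ?_ ?_
  · convert h1 using 3 with n ω
    rw [← Fin.sum_univ_eq_sum_range (fun j => f (a * ((j : ℝ) / (n + 1))) *
        ((X (a * (((j + 1 : ℕ) : ℝ) / (n + 1))) ω : ℂ) - X (a * ((j : ℝ) / (n + 1))) ω))]
    simp
  · intro n
    have : (n : ℝ) + 1 ≠ 0 := by positivity
    simp [this]
  · intro n i j hij
    have : ((i : ℕ) : ℝ) ≤ (j : ℕ) := by exact_mod_cast hij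
    dsimp only
    gcongr
  · have e (n : ℕ) : ⨆ k : Fin (n + 1), (a * (((k.succ : ℕ) : ℝ) / (n + 1)) -
        a * (((k.castSucc : ℕ) : ℝ) / (n + 1))) = a * (1 / (n + 1)) := by
      have e' (k : Fin (n + 1)) : a * (((k.succ : ℕ) : ℝ) / (n + 1)) -
        a * (((k.castSucc : ℕ) : ℝ) / (n + 1)) = a * (1 / (n + 1)) := by
        simp only [Fin.val_succ, Fin.val_castSucc]
        push_cast
        ring
      simp only [e', ciSup_const]
    simp_rw [e]
    simpa using tendsto_one_div_add_atTop_nhds_zero_nat.const_mul a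

/-- First-order scattering asymptotics for fractional Brownian motion with Hurst parameter
`H ∈ (0,1)`: for `w` of bounded variation on `[0,1]`, `s_k → 0` and `s_k ξ_k → L`,
`s_k^{-pH} E[|∫_0^{s_k} w(u/s_k) e^{iξ_k u} dX(u)|^p] → E[|∫_0^1 w(u) e^{iLu} dX(u)|^p]`. -/
theorem stmt13 {Ω : Type} [MeasureSpace Ω] [IsProbabilityMeasure (ℙ : Measure Ω)]
    (H : ℝ) (hH0 : 0 < H) (hH1 : H < 1) (p : ℝ) (hp : 1 ≤ p)
    (X : ℝ → Ω → ℝ) (hXmeas : ∀ r, Measurable (X r))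
    -- X is a centered Gaussian process
    (hgauss : ∀ (n : ℕ) (r : Fin n → ℝ) (c : Fin n → ℝ), ∃ v : NNReal,
      Measure.map (fun ω => ∑ i, c i * X (r i) ω) ℙ = ProbabilityTheory.gaussianReal 0 v)
    -- with fBM covariance
    (hcov : ∀ a b : ℝ,
      (∫ ω, X a ω * X b ω ∂ℙ) = (|a| ^ (2 * H) + |b| ^ (2 * H) - |a - b| ^ (2 * H)) / 2)
    (w : ℝ → ℝ) (hwBV : eVariationOn w (Set.Icc 0 1) ≠ ⊤)
    (s : ℕ → ℝ) (ξ : ℕ → ℝ) (hspos : ∀ k, 0 < s k) (hs0 : Tendsto s atTop (nhds 0))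
    (L : ℝ) (hsξ : Tendsto (fun k => s k * ξ k) atTop (nhds L))
    (I : ℕ → Ω → ℂ)
    (hI : ∀ k, IsStochInt ℙ X
      (fun u => (w (u / s k) : ℂ) * Complex.exp (Complex.I * ξ k * u)) (s k) (I k))
    (J : Ω → ℂ)
    (hJ : IsStochInt ℙ X (fun u => (w u : ℂ) * Complex.exp (Complex.I * L * u)) 1 J) :
    Tendsto (fun k => (∫ ω, ‖I k ω‖ ^ p ∂ℙ) / (s k) ^ (p * H)) atTop
      (nhds (∫ ω, ‖J ω‖ ^ p ∂ℙ)) := by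
  set P : ENNReal := ENNReal.ofReal p with hP
  set Q : ENNReal := ENNReal.ofReal (p + 1) with hQ
  have hp0 : 0 < p := by linarith
  have hP1 : 1 ≤ P := by rw [hP, ← ENNReal.ofReal_one]; exact ENNReal.ofReal_le_ofReal hp
  have hP0 : P ≠ 0 := (zero_lt_one.trans_le hP1).ne'
  have hPQ : P < Q := (ENNReal.ofReal_lt_ofReal_iff (by linarith)).2 (by linarith)
  have hPt : P ≠ ⊤ := ENNReal.ofReal_ne_top
  have hQt : Q ≠ ⊤ := ENNReal.ofReal_ne_top
  have hPp : P.toReal = p := ENNReal.toReal_ofReal hp0.le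
  let t (n j : ℕ) : ℝ := (j : ℝ) / (n + 1)
  let R (g : ℝ → ℂ) (n : ℕ) (ω : Ω) : ℂ := ∑ j ∈ Finset.range (n + 1),
    ((w (t n j) : ℂ) * g (t n j)) * ((X (t n (j + 1)) ω : ℂ) - X (t n j) ω)
  let φ (a u : ℝ) : ℂ := Complex.exp (Complex.I * a * u)
  have ht (n : ℕ) : Monotone (t n) := fun i j hij => by
    have : (i : ℝ) ≤ j := by exact_mod_cast hij
    dsimp only [t]
    gcongr
  have ht01 (n j : ℕ) (hj : j ≤ n + 1) : t n j ∈ Set.Icc (0 : ℝ) 1 := by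
    have : (j : ℝ) ≤ n + 1 := by exact_mod_cast hj
    exact ⟨by positivity, div_le_one_of_le₀ this (by positivity)⟩
  have hRm (g : ℝ → ℂ) (n : ℕ) : Measurable (R g n) := by
    dsimp only [R]
    fun_prop
  obtain ⟨A, hA0, hA⟩ := exists_sum_norm_mul_le hwBV
  have hbound (q : ENNReal) (hq : 1 ≤ q) (g : ℝ → ℂ) (G : ℝ)
      (hg : ∀ u ∈ Set.Icc (0 : ℝ) 1, ‖g u‖ ≤ G)
      (hg' : ∀ u ∈ Set.Icc (0 : ℝ) 1, ∀ v ∈ Set.Icc (0 : ℝ) 1, ‖g u - g v‖ ≤ G * |u - v|)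
      (n : ℕ) : eLpNorm (R g n) q ℙ ≤
        ENNReal.ofReal (A * G) * eLpNorm (fun ω => (X 1 ω : ℂ)) q ℙ := by
    refine (eLpNorm_sum_mul_sub_le hq (fun j => (w (t n j) : ℂ) * g (t n j))
      (Y := fun j ω => (X (t n j) ω : ℂ)) (fun _ => by fun_prop)
      (fun j hj => eLpNorm_le_eLpNorm_one hH0 hXmeas hgauss hcov q (ht01 n j hj))).trans ?_
    gcongr
    exact hA g G hg hg' (n + 1) (t n) (ht n) (ht01 n)
  have hφbound (a : ℝ) (n : ℕ) : eLpNorm (R (φ a) n) Q ℙ ≤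
      ENNReal.ofReal (A * (1 + |a|)) * eLpNorm (fun ω => (X 1 ω : ℂ)) Q ℙ := by
    refine hbound Q (hP1.trans hPQ.le) _ _ (fun u _ => ?_) (fun u _ v _ => ?_) n
    · rw [norm_exp_I_mul_mul]
      linarith [abs_nonneg a]
    · refine (norm_exp_I_mul_sub_exp_I_mul_le a u v).trans ?_
      gcongr
      linarith
  have hX1 (q : ENNReal) (hq : q ≠ ⊤) : eLpNorm (fun ω => (X 1 ω : ℂ)) q ℙ ≠ ⊤ :=
    (memLp_of_gaussian hXmeas hgauss hq 1).2.ne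
  have hscale (q : ENNReal) (g : ℝ → ℂ) {r : ℝ} (hr : 0 ≤ r) (n : ℕ) :
      eLpNorm (fun ω => ∑ j ∈ Finset.range (n + 1), ((w (t n j) : ℂ) * g (t n j)) *
        ((X (r * t n (j + 1)) ω : ℂ) - X (r * t n j) ω)) q ℙ =
      ENNReal.ofReal (r ^ H) * eLpNorm (R g n) q ℙ := by
    obtain ⟨b, hb⟩ := exists_sum_mul_sub_eq (fun j => (w (t n j) : ℂ) * g (t n j)) (n + 1)
    have h1 (ω : Ω) := hb (fun j => (X (r * t n j) ω : ℂ))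
    have h2 (ω : Ω) := hb (fun j => (X (t n j) ω : ℂ))
    dsimp only [R]
    simp only [h1, h2]
    exact eLpNorm_complex_sum_scaling hH0 hXmeas hgauss hcov q hr (fun i => t n i) b
  have hlim (a r : ℝ) (hr : 0 ≤ r) (f : ℝ → ℂ) (hf : ∀ u, f (r * u) = (w u : ℂ) * φ a u)
      (Y : Ω → ℂ) (hY : IsStochInt ℙ X f r Y) : MemLp Y P ℙ ∧
      Tendsto (fun n => ENNReal.ofReal (r ^ H) * eLpNorm (R (φ a) n) P ℙ) atTop
        (nhds (eLpNorm Y P ℙ)) := by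
    have h1 := hY.tendstoInMeasure_uniform hr
    simp only [hf] at h1
    have h2 := tendsto_eLpNorm_of_tendstoInMeasure_of_bddAbove hP1 hPQ hQt
      (B := ENNReal.ofReal (r ^ H) *
        (ENNReal.ofReal (A * (1 + |a|)) * eLpNorm (fun ω => (X 1 ω : ℂ)) Q ℙ)) ?_ ?_ ?_ h1
    · refine ⟨h2.1, h2.2.congr fun n => ?_⟩
      exact hscale P (φ a) hr n
    · exact ENNReal.mul_ne_top ENNReal.ofReal_ne_top
        (ENNReal.mul_ne_top ENNReal.ofReal_ne_top (hX1 Q hQt))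
    · intro n
      exact Measurable.aestronglyMeasurable (by fun_prop)
    · intro n
      refine (hscale Q (φ a) hr n).le.trans ?_
      gcongr
      exact hφbound a n
  obtain ⟨hJL, hJlim⟩ := hlim L 1 zero_le_one _ (fun u => by simp [φ]) J hJ
  simp only [Real.one_rpow, ENNReal.ofReal_one, one_mul] at hJlim
  have hIlim (k : ℕ) := hlim (s k * ξ k) (s k) (hspos k).le _ (fun u => by
    have := (hspos k).ne'
    dsimp only [φ]
    rw [mul_div_cancel_left₀ _ this]
    push_cast
    ring_nf) (I k) (hI k)
  let ε (k : ℕ) : ℝ := A * (|s k * ξ k - L| * (1 + |L|)) *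
    (eLpNorm (fun ω => (X 1 ω : ℂ)) P ℙ).toReal
  have hε0 (k : ℕ) : 0 ≤ ε k := by positivity
  have hε : Tendsto ε atTop (nhds 0) := by
    have h1 : Tendsto (fun k => |s k * ξ k - L|) atTop (nhds 0) := by
      simpa using (hsξ.sub_const L).abs
    simpa using ((h1.mul_const (1 + |L|)).const_mul A).mul_const
      (eLpNorm (fun ω => (X 1 ω : ℂ)) P ℙ).toReal
  have hdiff (k n : ℕ) : eLpNorm (R (φ (s k * ξ k)) n - R (φ L) n) P ℙ ≤
      ENNReal.ofReal (ε k) := by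
    have e : R (φ (s k * ξ k)) n - R (φ L) n = R (fun u => φ (s k * ξ k) u - φ L u) n := by
      ext ω
      simp only [R, Pi.sub_apply, ← Finset.sum_sub_distrib]
      refine Finset.sum_congr rfl fun j _ => ?_
      ring
    rw [e, ENNReal.ofReal_mul (by positivity), ENNReal.ofReal_toReal (hX1 P hPt)]
    exact hbound P hP1 _ _ (fun u hu => norm_exp_I_mul_sub_le _ _ hu)
      (fun u hu v _ => norm_exp_I_mul_sub_sub_le _ _ hu) n
  have hcmp (k : ℕ) : |lpNorm (I k) P ℙ / s k ^ H - lpNorm J P ℙ| ≤ ε k := by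
    have hc : 0 < s k ^ H := Real.rpow_pos_of_pos (hspos k) H
    have hub : eLpNorm (I k) P ℙ ≤
        ENNReal.ofReal (s k ^ H) * (eLpNorm J P ℙ + ENNReal.ofReal (ε k)) := by
      refine le_of_tendsto_of_tendsto' (hIlim k).2 (ENNReal.Tendsto.const_mul
        (hJlim.add_const (ENNReal.ofReal (ε k))) (Or.inr ENNReal.ofReal_ne_top)) fun n => ?_
      gcongr
      have := eLpNorm_add_le (hRm (φ L) n).aestronglyMeasurable (μ := ℙ)
        ((hRm (φ (s k * ξ k)) n).sub (hRm (φ L) n)).aestronglyMeasurable hP1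
      rw [add_sub_cancel] at this
      exact this.trans (by gcongr; exact hdiff k n)
    have hlb : ENNReal.ofReal (s k ^ H) * eLpNorm J P ℙ ≤
        eLpNorm (I k) P ℙ + ENNReal.ofReal (s k ^ H) * ENNReal.ofReal (ε k) := by
      refine le_of_tendsto_of_tendsto' (ENNReal.Tendsto.const_mul hJlim
        (Or.inr ENNReal.ofReal_ne_top)) ((hIlim k).2.add_const _) fun n => ?_
      rw [← mul_add]
      gcongr
      have := eLpNorm_sub_le (hRm (φ (s k * ξ k)) n).aestronglyMeasurable (μ := ℙ)
        ((hRm (φ (s k * ξ k)) n).sub (hRm (φ L) n)).aestronglyMeasurable hP1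
      rw [sub_sub_cancel] at this
      exact this.trans (by gcongr; exact hdiff k n)
    rw [← ofReal_lpNorm hJL, ← ofReal_lpNorm (hIlim k).1,
      ← ENNReal.ofReal_add lpNorm_nonneg (hε0 k), ← ENNReal.ofReal_mul hc.le,
      ENNReal.ofReal_le_ofReal_iff
        (mul_nonneg hc.le (add_nonneg lpNorm_nonneg (hε0 k)))] at hub
    rw [← ofReal_lpNorm hJL, ← ofReal_lpNorm (hIlim k).1,
      ← ENNReal.ofReal_mul hc.le, ← ENNReal.ofReal_mul hc.le,
      ← ENNReal.ofReal_add lpNorm_nonneg (mul_nonneg hc.le (hε0 k)),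
      ENNReal.ofReal_le_ofReal_iff
        (add_nonneg lpNorm_nonneg (mul_nonneg hc.le (hε0 k)))] at hlb
    rw [abs_le]
    constructor
    · rw [le_sub_iff_add_le, le_div_iff₀ hc]
      linarith
    · rw [sub_le_iff_le_add, div_le_iff₀ hc]
      linarith
  have hconv : Tendsto (fun k => lpNorm (I k) P ℙ / s k ^ H) atTop (nhds (lpNorm J P ℙ)) := by
    rw [tendsto_iff_dist_tendsto_zero]
    exact squeeze_zero (fun _ => dist_nonneg) hcmp hε
  have hpow {Y : Ω → ℂ} (hY : MemLp Y P ℙ) : lpNorm Y P ℙ ^ p = ∫ ω, ‖Y ω‖ ^ p ∂ℙ := by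
    rw [lpNorm_eq_integral_norm_rpow_toReal hP0 hPt hY.1, hPp,
      Real.rpow_inv_rpow (integral_nonneg fun _ => by positivity) hp0.ne']
  rw [← hpow hJL]
  refine (hconv.rpow_const (Or.inr hp0.le)).congr fun k => ?_
  rw [Real.div_rpow lpNorm_nonneg (Real.rpow_nonneg (hspos k).le _), hpow (hIlim k).1,
    ← Real.rpow_mul (hspos k).le, mul_comm H p]
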